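/- arXiv:2604.11356 — 10 statements merged into one kernel-verified Lean document; each statement's English description precedes it below -/
import Mathlib

section
/- Let Z ⊆ V be a subspace and Q_h ⊆ Q a subspace such that b(v, q') = 0 for all v ∈ Z and all q' ∈ Q_h. Suppose y, y_h ∈ V, p ∈ Q and p_h ∈ Q_h satisfy the Galerkin-type orthogonality ⟨y − y_h, v⟩_V = b(v, p − p_h) for all v ∈ Z. Then for every w ∈ V with y_h − w ∈ Z and every q ∈ Q_h there holds the quasi-best-approximation estimate ‖y − y_h‖_V ≤ 2·‖y − w‖_V + ‖p − q‖_Q. (This is the paper's Lemma 'best approximation in Y_{*h}^div', with Z the space Y_{0h}^div of discretely divergence-free discrete velocities and w ranging over Y_{*h}^div.) -/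
/-- Paper's Lemma "best approximation in `Y_{*h}^div`": with `Z` the discretely
divergence-free discrete velocity test space and `Q_h` the discrete pressure space on
which `b` vanishes against `Z`, the Galerkin-type orthogonality yields the
quasi-best-approximation estimate `‖y − y_h‖ ≤ 2‖y − w‖ + ‖p − q‖` for every
`w` with `y_h − w ∈ Z` and every `q ∈ Q_h`. -/
theorem best_approx_div_free
    {V Q : Type*} [NormedAddCommGroup V] [InnerProductSpace ℝ V]
    [NormedAddCommGroup Q] [NormedSpace ℝ Q]
    (b : V →ₗ[ℝ] Q →ₗ[ℝ] ℝ)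
    (hb : ∀ (v : V) (q : Q), |b v q| ≤ ‖v‖ * ‖q‖)
    (Z : Submodule ℝ V) (Qh : Submodule ℝ Q)
    (hZQh : ∀ v ∈ Z, ∀ q' ∈ Qh, b v q' = 0)
    (y yh : V) (p ph : Q) (hph : ph ∈ Qh)
    (hGalerkin : ∀ v ∈ Z, inner (𝕜 := ℝ) (y - yh) v = b v (p - ph)) :
    ∀ w : V, yh - w ∈ Z → ∀ q ∈ Qh, ‖y - yh‖ ≤ 2 * ‖y - w‖ + ‖p - q‖ := by
  intro w hw q hq
  have hbq : b (yh - w) (p - ph) = b (yh - w) (p - q) := by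
    rw [map_sub (b (yh - w)), map_sub (b (yh - w)), hZQh _ hw ph hph, hZQh _ hw q hq]
  have hsq : ‖yh - w‖ * ‖yh - w‖ =
      inner ℝ (y - w) (yh - w) - b (yh - w) (p - q) := by
    rw [← hbq, ← hGalerkin _ hw, ← inner_sub_left, sub_sub_sub_cancel_left,
      real_inner_self_eq_norm_mul_norm]
  have hz : ‖yh - w‖ ≤ ‖y - w‖ + ‖p - q‖ := by
    rcases (norm_nonneg (yh - w)).eq_or_lt with h0 | hpos
    · rw [← h0]
      positivity
    · refine le_of_mul_le_mul_right ?_ hpos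
      linarith [real_inner_le_norm (y - w) (yh - w), hb (yh - w) (p - q),
        neg_abs_le (b (yh - w) (p - q))]
  have htri : ‖y - yh‖ ≤ ‖y - w‖ + ‖yh - w‖ := by
    simpa using norm_sub_le (y - w) (yh - w)
  linarith
end

section
/- Suppose y, y_h ∈ V, p ∈ Q and p_h ∈ Q_h satisfy the Galerkin orthogonality ⟨y − y_h, v⟩_V = b(v, p − p_h) for all v ∈ V₀h. Then for every q ∈ Q_h there holds the pressure error estimate ‖p − p_h‖_Q ≤ α⁻¹·‖y − y_h‖_V + (α⁻¹ + 1)·‖p − q‖_Q. (This is the paper's Lemma 'error estimate for the pressure'.) -/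
/-- Paper's Lemma "error estimate for the pressure": under the discrete inf-sup
condition with constant `α`, the Galerkin orthogonality implies
`‖p − p_h‖ ≤ α⁻¹‖y − y_h‖ + (α⁻¹ + 1)‖p − q‖` for every `q ∈ Q_h`. -/
theorem pressure_error_estimate
    {V Q : Type*} [NormedAddCommGroup V] [InnerProductSpace ℝ V]
    [NormedAddCommGroup Q] [NormedSpace ℝ Q]
    (b : V →ₗ[ℝ] Q →ₗ[ℝ] ℝ)
    (hb : ∀ (v : V) (q : Q), |b v q| ≤ ‖v‖ * ‖q‖)
    (V0h : Submodule ℝ V) (Qh : Submodule ℝ Q)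
    (α : ℝ) (hα : 0 < α)
    (hinfsup : ∀ q' ∈ Qh,
      α * ‖q'‖ ≤ sSup {r : ℝ | ∃ v ∈ V0h, v ≠ 0 ∧ r = b v q' / ‖v‖})
    (y yh : V) (p ph : Q) (hph : ph ∈ Qh)
    (hGalerkin : ∀ v ∈ V0h, inner (𝕜 := ℝ) (y - yh) v = b v (p - ph)) :
    ∀ q ∈ Qh, ‖p - ph‖ ≤ α⁻¹ * ‖y - yh‖ + (α⁻¹ + 1) * ‖p - q‖ := by
  intro q hq
  have hsup : α * ‖q - ph‖ ≤ ‖y - yh‖ + ‖p - q‖ := by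
    refine (hinfsup _ (Qh.sub_mem hq hph)).trans (Real.sSup_le ?_ (by positivity))
    rintro r ⟨v, hv, hv0, rfl⟩
    rw [div_le_iff₀ (norm_pos_iff.mpr hv0)]
    have hsplit : b v (q - ph) = inner ℝ (y - yh) v - b v (p - q) := by
      rw [hGalerkin v hv, ← map_sub, sub_sub_sub_cancel_left]
    have hinner := real_inner_le_norm (y - yh) v
    have hbound := (neg_le_abs _).trans (hb v (p - q))
    linarith
  have hdiscrete : ‖q - ph‖ ≤ α⁻¹ * (‖y - yh‖ + ‖p - q‖) :=
    (le_inv_mul_iff₀ hα).mpr hsup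
  have htriangle := norm_sub_le_norm_sub_add_norm_sub p q ph
  linarith
end

section
/- Let y ∈ V satisfy ⟨By, q'⟩_Q = 0 for all q' ∈ Q_h. Then for every w ∈ V there exists w' ∈ V such that w − w' ∈ V₀h, ⟨Bw', q'⟩_Q = 0 for all q' ∈ Q_h (w' is discretely divergence free), and ‖y − w'‖_V ≤ (1 + α⁻¹)·‖y − w‖_V. (This is the paper's Lemma 'from Y_{*h}^div to Y_{*h}'.) -/
/-- Paper's Lemma "from `Y_{*h}^div` to `Y_{*h}`": if `y` is discretely divergence
free (`⟨By, q'⟩ = 0` for all discrete pressures `q'`), then any `w` can be corrected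
by an element of `V₀h` to a discretely divergence-free `w'` with
`‖y − w'‖ ≤ (1 + α⁻¹)‖y − w‖`. -/
theorem from_div_free_correction
    {V Q : Type*} [NormedAddCommGroup V] [InnerProductSpace ℝ V]
    [NormedAddCommGroup Q] [InnerProductSpace ℝ Q] [CompleteSpace Q]
    (Qh : Submodule ℝ Q) (hQh : IsClosed (Qh : Set Q))
    (B : V →ₗ[ℝ] Q) (hB : ∀ v : V, ‖B v‖ ≤ ‖v‖)
    (V0h : Submodule ℝ V)
    (α : ℝ) (hα : 0 < α)
    (hinfsup : ∀ q' ∈ Qh, ∃ v ∈ V0h, B v = q' ∧ ‖v‖ ≤ α⁻¹ * ‖q'‖)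
    (y : V) (hy : ∀ q' ∈ Qh, inner (𝕜 := ℝ) (B y) q' = (0 : ℝ)) :
    ∀ w : V, ∃ w' : V, w - w' ∈ V0h ∧
      (∀ q' ∈ Qh, inner (𝕜 := ℝ) (B w') q' = (0 : ℝ)) ∧
      ‖y - w'‖ ≤ (1 + α⁻¹) * ‖y - w‖ := by
  intro w
  have : CompleteSpace Qh := hQh.completeSpace_coe
  obtain ⟨v, hv, hBv, hv_norm⟩ :=
    hinfsup (Qh.starProjection (B (y - w))) (Qh.starProjection_apply_mem _)
  refine ⟨w + v, by simpa using hv, fun q' hq' => ?_, ?_⟩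
  · have h_split : B (w + v) = B y - (B (y - w) - Qh.starProjection (B (y - w))) := by
      rw [map_add, hBv, map_sub]
      abel
    rw [h_split, inner_sub_left, hy q' hq', Qh.starProjection_inner_eq_zero _ _ hq', sub_zero]
  · have h_proj : ‖Qh.starProjection (B (y - w))‖ ≤ ‖y - w‖ :=
      (Qh.norm_starProjection_apply_le _).trans (hB _)
    calc ‖y - (w + v)‖ = ‖(y - w) - v‖ := by rw [sub_sub]
      _ ≤ ‖y - w‖ + ‖v‖ := norm_sub_le _ _
      _ ≤ ‖y - w‖ + α⁻¹ * ‖y - w‖ := by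
        gcongr
        exact hv_norm.trans (by gcongr)
      _ = (1 + α⁻¹) * ‖y - w‖ := by ring
end

section
/- For all α, ω ∈ ℝ, the velocity field y is divergence-free on the slit plane: for every x ∈ Ω₀, ∂₁y₁(x) + ∂₂y₂(x) = 0, where ∂ᵢ denotes the classical partial derivative in the i-th coordinate direction. (This is the divergence part of the paper's claim that the manufactured corner-singularity solution solves the homogeneous Stokes equations for any α ∈ ℝ.) -/
open Real

/-- Angular part `Φ₁` of the first velocity component of the manufactured
corner-singularity solution. -/
noncomputable def Phi1 (α ω θ : ℝ) : ℝ :=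
  -Real.sin (α * θ) * Real.cos ω - α * Real.sin θ * Real.cos (α * (ω - θ) + θ)
    + α * Real.sin (ω - θ) * Real.cos (α * θ - θ) + Real.sin (α * (ω - θ))

/-- Angular part `Φ₂` of the second velocity component. -/
noncomputable def Phi2 (α ω θ : ℝ) : ℝ :=
  -Real.sin (α * θ) * Real.sin ω - α * Real.sin θ * Real.sin (α * (ω - θ) + θ)
    - α * Real.sin (ω - θ) * Real.sin (α * θ - θ)

/-- Radial distance `r(x)`. -/
noncomputable def rad (x : ℝ × ℝ) : ℝ := Real.sqrt (x.1 ^ 2 + x.2 ^ 2)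

/-- Polar angle `θ(x) ∈ (−π, π]`, the argument of `x₁ + i x₂` (standard branch). -/
noncomputable def ang (x : ℝ × ℝ) : ℝ := Complex.arg (x.1 + x.2 * Complex.I)

/-- The manufactured corner-singularity velocity field
`y(x) = r(x)^α (Φ₁(θ(x)), Φ₂(θ(x)))`. -/
noncomputable def vel (α ω : ℝ) (x : ℝ × ℝ) : ℝ × ℝ :=
  (rad x ^ α * Phi1 α ω (ang x), rad x ^ α * Phi2 α ω (ang x))

/-- Derivative of `Phi1` in the angular variable. -/
noncomputable def derivPhi1 (α ω θ : ℝ) : ℝ :=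
  -(α * cos (α * θ)) * cos ω
    - α * (cos θ * cos (α * (ω - θ) + θ) - sin θ * sin (α * (ω - θ) + θ) * (1 - α))
    + α * (-cos (ω - θ) * cos (α * θ - θ) - sin (ω - θ) * sin (α * θ - θ) * (α - 1))
    - α * cos (α * (ω - θ))

/-- Derivative of `Phi2` in the angular variable. -/
noncomputable def derivPhi2 (α ω θ : ℝ) : ℝ :=
  -(α * cos (α * θ)) * sin ω
    - α * (cos θ * sin (α * (ω - θ) + θ) + sin θ * cos (α * (ω - θ) + θ) * (1 - α))
    - α * (-cos (ω - θ) * sin (α * θ - θ) + sin (ω - θ) * cos (α * θ - θ) * (α - 1))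

theorem hasDerivAt_Phi1 (α ω θ : ℝ) : HasDerivAt (Phi1 α ω) (derivPhi1 α ω θ) θ := by
  have hid := hasDerivAt_id' θ
  have ha := hid.const_mul α
  have hw := hid.const_sub ω
  have hb := hw.const_mul α
  have h := ((((ha.sin.fun_neg.mul_const (cos ω)).fun_sub
    ((hid.sin.const_mul α).fun_mul (hb.fun_add hid).cos)).fun_add
    ((hw.sin.const_mul α).fun_mul (ha.fun_sub hid).cos)).fun_add hb.sin)
  refine h.congr_deriv ?_
  unfold derivPhi1
  ring

theorem hasDerivAt_Phi2 (α ω θ : ℝ) : HasDerivAt (Phi2 α ω) (derivPhi2 α ω θ) θ := by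
  have hid := hasDerivAt_id' θ
  have ha := hid.const_mul α
  have hw := hid.const_sub ω
  have hb := hw.const_mul α
  have h := (((ha.sin.fun_neg.mul_const (sin ω)).fun_sub
    ((hid.sin.const_mul α).fun_mul (hb.fun_add hid).sin)).fun_sub
    ((hw.sin.const_mul α).fun_mul (ha.fun_sub hid).sin))
  refine h.congr_deriv ?_
  unfold derivPhi2
  ring

/-- The divergence-free condition in polar coordinates, with the radial factor removed. -/
theorem angular_divergence_eq_zero (α ω θ : ℝ) :
    (α * cos θ * Phi1 α ω θ - sin θ * derivPhi1 α ω θ)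
      + (α * sin θ * Phi2 α ω θ + cos θ * derivPhi2 α ω θ) = 0 := by
  unfold Phi1 Phi2 derivPhi1 derivPhi2
  simp only [sin_add, cos_add, sin_sub, cos_sub]
  generalize α * θ = a
  generalize α * (ω - θ) = b
  have ht := sin_sq_add_cos_sq θ
  generalize sin θ = s at *
  generalize cos θ = c at *
  generalize sin a = sa
  generalize cos a = ca
  generalize sin b = sb
  generalize cos b = cb
  generalize sin ω = sw
  generalize cos ω = cw
  grind

theorem rad_pos {x : ℝ × ℝ} (hx : ¬(x.2 = 0 ∧ x.1 ≤ 0)) : 0 < rad x := by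
  refine sqrt_pos.2 ?_
  by_cases h : x.2 = 0
  · have : 0 < x.1 := not_le.1 fun h' => hx ⟨h, h'⟩
    positivity
  · positivity

theorem rad_eq_norm (x : ℝ × ℝ) : rad x = ‖(x.1 + x.2 * Complex.I : ℂ)‖ :=
  (Complex.norm_add_mul_I x.1 x.2).symm

theorem rad_mul_cos_ang (x : ℝ × ℝ) : rad x * cos (ang x) = x.1 := by
  rw [rad_eq_norm, ang, Complex.norm_mul_cos_arg]
  simp

theorem rad_mul_sin_ang (x : ℝ × ℝ) : rad x * sin (ang x) = x.2 := by
  rw [rad_eq_norm, ang, Complex.norm_mul_sin_arg]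
  simp

theorem mem_slitPlane_of_not_slit {x : ℝ × ℝ} (hx : ¬(x.2 = 0 ∧ x.1 ≤ 0)) :
    (x.1 + x.2 * Complex.I : ℂ) ∈ Complex.slitPlane := by
  rw [Complex.mem_slitPlane_iff]
  by_cases h : x.2 = 0
  · left
    simpa [h] using fun h' => hx ⟨h, h'⟩
  · right
    simpa using h

theorem inv_eq_polar (x : ℝ × ℝ) (hx : 0 < rad x) :
    (x.1 + x.2 * Complex.I : ℂ)⁻¹
      = (cos (ang x) / rad x : ℝ) - (sin (ang x) / rad x : ℝ) * Complex.I := by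
  have hsq : Complex.normSq (x.1 + x.2 * Complex.I : ℂ) = rad x * rad x := by
    rw [rad_eq_norm, Complex.norm_mul_self_eq_normSq]
  have h₁ := rad_mul_cos_ang x
  have h₂ := rad_mul_sin_ang x
  apply Complex.ext
  · rw [Complex.inv_re, hsq]
    simp [-Complex.ofReal_div]
    field_simp
    linarith
  · rw [Complex.inv_im, hsq]
    simp [-Complex.ofReal_div]
    field_simp
    linarith

theorem hasDerivAt_ang_fst {x : ℝ × ℝ} (hx : ¬(x.2 = 0 ∧ x.1 ≤ 0)) :
    HasDerivAt (fun s => ang (s, x.2)) (-(sin (ang x) / rad x)) x.1 := by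
  have hz : HasDerivAt (fun s : ℝ => (s + x.2 * Complex.I : ℂ)) 1 x.1 :=
    (hasDerivAt_id x.1).ofReal_comp.add_const _
  have h := Complex.imCLM.hasFDerivAt.comp_hasDerivAt x.1
    (hz.clog_real (mem_slitPlane_of_not_slit hx))
  rw [one_div, inv_eq_polar x (rad_pos hx)] at h
  refine (h.congr_deriv ?_).congr_of_eventuallyEq (.of_forall fun s => ?_)
  · simp [-Complex.ofReal_div]
  · simp [ang, Complex.log_im]

theorem hasDerivAt_ang_snd {x : ℝ × ℝ} (hx : ¬(x.2 = 0 ∧ x.1 ≤ 0)) :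
    HasDerivAt (fun s => ang (x.1, s)) (cos (ang x) / rad x) x.2 := by
  have hz : HasDerivAt (fun s : ℝ => (x.1 + s * Complex.I : ℂ)) (1 * Complex.I) x.2 :=
    ((hasDerivAt_id x.2).ofReal_comp.mul_const _).const_add _
  have h := Complex.imCLM.hasFDerivAt.comp_hasDerivAt x.2
    (hz.clog_real (mem_slitPlane_of_not_slit hx))
  rw [one_mul, div_eq_mul_inv, inv_eq_polar x (rad_pos hx)] at h
  refine (h.congr_deriv ?_).congr_of_eventuallyEq (.of_forall fun s => ?_)
  · simp [-Complex.ofReal_div]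
  · simp [ang, Complex.log_im]

theorem hasDerivAt_rad_fst {x : ℝ × ℝ} (hx : 0 < rad x) :
    HasDerivAt (fun s => rad (s, x.2)) (cos (ang x)) x.1 := by
  refine ((((hasDerivAt_id' x.1).fun_pow 2).add_const (x.2 ^ 2)).sqrt
    (sqrt_pos.1 hx).ne').congr_deriv ?_
  change _ / (2 * rad x) = _
  have h := rad_mul_cos_ang x
  field_simp
  norm_num
  linarith

theorem hasDerivAt_rad_snd {x : ℝ × ℝ} (hx : 0 < rad x) :
    HasDerivAt (fun s => rad (x.1, s)) (sin (ang x)) x.2 := by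
  refine ((((hasDerivAt_id' x.2).fun_pow 2).const_add (x.1 ^ 2)).sqrt
    (sqrt_pos.1 hx).ne').congr_deriv ?_
  change _ / (2 * rad x) = _
  have h := rad_mul_sin_ang x
  field_simp
  norm_num
  linarith

/-- Divergence part of the paper's claim: the manufactured corner-singularity
velocity field is divergence-free on the slit plane
`Ω₀ = ℝ² ∖ {(x₁,0) : x₁ ≤ 0}`, for any `α, ω ∈ ℝ`: the classical partial
derivatives `∂₁y₁` and `∂₂y₂` exist at every `x ∈ Ω₀` and sum to zero. -/
theorem manufactured_velocity_divergence_free (α ω : ℝ) (x : ℝ × ℝ)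
    (hx : ¬(x.2 = 0 ∧ x.1 ≤ 0)) :
    ∃ d₁ d₂ : ℝ,
      HasDerivAt (fun s => (vel α ω (s, x.2)).1) d₁ x.1 ∧
      HasDerivAt (fun s => (vel α ω (x.1, s)).2) d₂ x.2 ∧
      d₁ + d₂ = 0 := by
  have hr := rad_pos hx
  have hΦ₁ := HasDerivAt.comp (h₂ := Phi1 α ω) x.1
    (hasDerivAt_Phi1 α ω (ang x)) (hasDerivAt_ang_fst hx)
  have hΦ₂ := HasDerivAt.comp (h₂ := Phi2 α ω) x.2
    (hasDerivAt_Phi2 α ω (ang x)) (hasDerivAt_ang_snd hx)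
  refine ⟨_, _, ((hasDerivAt_rad_fst hr).rpow_const (p := α) (.inl hr.ne')).fun_mul hΦ₁,
    ((hasDerivAt_rad_snd hr).rpow_const (p := α) (.inl hr.ne')).fun_mul hΦ₂, ?_⟩
  have hpow : rad x ^ α = rad x ^ (α - 1) * rad x := by
    rw [← rpow_add_one hr.ne', sub_add_cancel]
  simp only [Prod.mk.eta, hpow]
  field_simp
  linear_combination rad x ^ (α - 1) * angular_divergence_eq_zero α ω (ang x)
end

section
/- For all α, ω ∈ ℝ, the pair (y, p) satisfies the homogeneous Stokes momentum equation classically on the slit plane: for every x ∈ Ω₀ and each component i ∈ {1,2}, ∂₁₁yᵢ(x) + ∂₂₂yᵢ(x) = ∂ᵢp(x), i.e. −Δy + ∇p = 0 on Ω₀, where the second partial derivatives are classical. (This is the momentum part of the paper's claim that the manufactured corner-singularity solution solves the homogeneous Stokes equations for any α ∈ ℝ.) -/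
open Real

/-- Angular part `Φ_p` of the pressure. -/
noncomputable def Phip (α ω θ : ℝ) : ℝ :=
  2 * α * (Real.sin ((α - 1) * θ + ω) + Real.sin ((α - 1) * θ - α * ω))

/-- The manufactured corner-singularity pressure `p(x) = r(x)^{α−1} Φ_p(θ(x))`. -/
noncomputable def press (α ω : ℝ) (x : ℝ × ℝ) : ℝ :=
  rad x ^ (α - 1) * Phip α ω (ang x)

/-- The point `s + i t` of the complex plane. -/
noncomputable def planePoint (s t : ℝ) : ℂ := s + t * Complex.I

/-- The harmonic function `(s, t) ↦ Im (a z ^ γ)`, `z = s + i t`, on the slit plane. -/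
noncomputable def imPow (γ : ℝ) (a : ℂ) (s t : ℝ) : ℝ :=
  (a * Complex.exp (γ * Complex.log (planePoint s t))).im

theorem planePoint_mem_slitPlane {s t : ℝ} :
    planePoint s t ∈ Complex.slitPlane ↔ ¬(t = 0 ∧ s ≤ 0) := by
  simp [planePoint, Complex.mem_slitPlane_iff, or_iff_not_imp_right]

theorem imPow_add (γ : ℝ) (a b : ℂ) (s t : ℝ) :
    imPow γ (a + b) s t = imPow γ a s t + imPow γ b s t := by
  simp only [imPow, add_mul, Complex.add_im]

theorem imPow_neg (γ : ℝ) (a : ℂ) (s t : ℝ) : imPow γ (-a) s t = -imPow γ a s t := by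
  simp only [imPow, neg_mul, Complex.neg_im]

theorem hasDerivAt_mul_exp_log (γ : ℝ) (a : ℂ) {z : ℂ} (hz : z ∈ Complex.slitPlane) :
    HasDerivAt (fun w : ℂ => a * Complex.exp (γ * Complex.log w))
      (γ * a * Complex.exp ((γ - 1 : ℝ) * Complex.log z)) z := by
  have hz0 : z ≠ 0 := Complex.slitPlane_ne_zero hz
  refine ((((Complex.hasDerivAt_log hz).const_mul (γ : ℂ)).cexp).const_mul a).congr_deriv ?_
  have h : ((γ - 1 : ℝ) : ℂ) * Complex.log z = γ * Complex.log z - Complex.log z := by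
    push_cast; ring
  rw [h, Complex.exp_sub, Complex.exp_log hz0]
  field_simp

theorem hasDerivAt_imPow_fst (γ : ℝ) (a : ℂ) {s t : ℝ}
    (h : planePoint s t ∈ Complex.slitPlane) :
    HasDerivAt (fun s => imPow γ a s t) (imPow (γ - 1) (γ * a) s t) s := by
  have hline : HasDerivAt (fun s : ℝ => planePoint s t) 1 s :=
    (Complex.ofRealCLM.hasDerivAt (x := s)).add_const _
  have hcomp := (hasDerivAt_mul_exp_log γ a h).comp s hline
  refine (Complex.imCLM.hasFDerivAt.comp_hasDerivAt s hcomp).congr_deriv ?_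
  simp [imPow]

theorem hasDerivAt_imPow_snd (γ : ℝ) (a : ℂ) {s t : ℝ}
    (h : planePoint s t ∈ Complex.slitPlane) :
    HasDerivAt (fun t => imPow γ a s t) (imPow (γ - 1) (γ * (Complex.I * a)) s t) t := by
  have hline : HasDerivAt (fun t : ℝ => planePoint s t) (1 * Complex.I) t :=
    ((Complex.ofRealCLM.hasDerivAt (x := t)).mul_const _).const_add _
  have hcomp := (hasDerivAt_mul_exp_log γ a h).comp t hline
  refine (Complex.imCLM.hasFDerivAt.comp_hasDerivAt t hcomp).congr_deriv ?_
  simp only [imPow, Complex.imCLM_apply]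
  congr 1
  ring

theorem eventually_planePoint_fst {s t : ℝ} (h : planePoint s t ∈ Complex.slitPlane) :
    ∀ᶠ s' in nhds s, planePoint s' t ∈ Complex.slitPlane := by
  have hc : Continuous fun s' : ℝ => planePoint s' t := by unfold planePoint; fun_prop
  exact hc.continuousAt.eventually_mem (Complex.isOpen_slitPlane.mem_nhds h)

theorem eventually_planePoint_snd {s t : ℝ} (h : planePoint s t ∈ Complex.slitPlane) :
    ∀ᶠ t' in nhds t, planePoint s t' ∈ Complex.slitPlane := by
  have hc : Continuous fun t' : ℝ => planePoint s t' := by unfold planePoint; fun_prop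
  exact hc.continuousAt.eventually_mem (Complex.isOpen_slitPlane.mem_nhds h)

/-- The field `Im (a z ^ α) + s Im (b z ^ β) + t Im (c z ^ β)`, `z = s + i t`. -/
noncomputable def almansi (α β : ℝ) (a b c : ℂ) (s t : ℝ) : ℝ :=
  imPow α a s t + s * imPow β b s t + t * imPow β c s t

/-- The Laplacian of `almansi α β a b c` is `2 β Im ((b + i c) z ^ (β - 1))`. -/
theorem laplacian_almansi (α β : ℝ) (a b c : ℂ) {s t : ℝ}
    (h : planePoint s t ∈ Complex.slitPlane) :
    ∃ d₁ d₂ : ℝ,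
      HasDerivAt (deriv fun s => almansi α β a b c s t) d₁ s ∧
      HasDerivAt (deriv fun t => almansi α β a b c s t) d₂ t ∧
      d₁ + d₂ = imPow (β - 1) (β * (2 * (b + Complex.I * c))) s t := by
  have hfst : deriv (fun s => almansi α β a b c s t) =ᶠ[nhds s] fun s =>
      imPow (α - 1) (α * a) s t + (1 * imPow β b s t + s * imPow (β - 1) (β * b) s t)
        + t * imPow (β - 1) (β * c) s t := by
    filter_upwards [eventually_planePoint_fst h] with s' h'
    exact (((hasDerivAt_imPow_fst α a h').add
      ((hasDerivAt_id s').mul (hasDerivAt_imPow_fst β b h'))).add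
      ((hasDerivAt_imPow_fst β c h').const_mul t)).deriv
  have hsnd : deriv (fun t => almansi α β a b c s t) =ᶠ[nhds t] fun t =>
      imPow (α - 1) (α * (Complex.I * a)) s t + s * imPow (β - 1) (β * (Complex.I * b)) s t
        + (1 * imPow β c s t + t * imPow (β - 1) (β * (Complex.I * c)) s t) := by
    filter_upwards [eventually_planePoint_snd h] with t' h'
    exact (((hasDerivAt_imPow_snd α a h').add
      ((hasDerivAt_imPow_snd β b h').const_mul s)).add
      ((hasDerivAt_id t').mul (hasDerivAt_imPow_snd β c h'))).deriv
  refine ⟨_, _, HasDerivAt.congr_of_eventuallyEq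
    (((hasDerivAt_imPow_fst _ _ h).add
      (((hasDerivAt_imPow_fst β b h).const_mul 1).add
        ((hasDerivAt_id s).mul (hasDerivAt_imPow_fst _ _ h)))).add
      ((hasDerivAt_imPow_fst _ _ h).const_mul t)) hfst,
    HasDerivAt.congr_of_eventuallyEq
    (((hasDerivAt_imPow_snd _ _ h).add
      ((hasDerivAt_imPow_snd _ _ h).const_mul s)).add
      (((hasDerivAt_imPow_snd β c h).const_mul 1).add
        ((hasDerivAt_id t).mul (hasDerivAt_imPow_snd _ _ h)))) hsnd, ?_⟩
  have hneg (γ δ : ℝ) (e : ℂ) : imPow (γ - 1) ((γ : ℂ) * (Complex.I * (δ * (Complex.I * e)))) s t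
      = -imPow (γ - 1) (γ * (δ * e)) s t := by
    rw [← imPow_neg]
    congr 1
    linear_combination (γ * δ * e : ℂ) * Complex.I_mul_I
  have hsplit : (β : ℂ) * (2 * (b + Complex.I * c))
      = (β * b + β * b) + (β * (Complex.I * c) + β * (Complex.I * c)) := by ring
  rw [hsplit, imPow_add, imPow_add, imPow_add, hneg, hneg, hneg]
  simp only [id]
  ring

theorem rad_eq_norm_s8 (s t : ℝ) : rad (s, t) = ‖planePoint s t‖ := by
  rw [rad, planePoint, Complex.norm_add_mul_I]

/-- Polar form of `imPow`. -/
theorem imPow_eq_rad_ang (γ : ℝ) (a : ℂ) {s t : ℝ}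
    (h : planePoint s t ∈ Complex.slitPlane) :
    imPow γ a s t = rad (s, t) ^ γ *
      (a.re * Real.sin (γ * ang (s, t)) + a.im * Real.cos (γ * ang (s, t))) := by
  have hpos : 0 < ‖planePoint s t‖ := norm_pos_iff.mpr (Complex.slitPlane_ne_zero h)
  have hang : ang (s, t) = (planePoint s t).arg := rfl
  have hre : ((γ : ℂ) * Complex.log (planePoint s t)).re = Real.log ‖planePoint s t‖ * γ := by
    rw [Complex.re_ofReal_mul, Complex.log_re, mul_comm]
  have him : ((γ : ℂ) * Complex.log (planePoint s t)).im = γ * ang (s, t) := by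
    rw [Complex.im_ofReal_mul, Complex.log_im, hang]
  rw [imPow, Complex.mul_im, Complex.exp_re, Complex.exp_im, hre, him, rad_eq_norm_s8,
    Real.rpow_def_of_pos hpos]
  ring

theorem rad_mul_cos_ang_s8 (s t : ℝ) : rad (s, t) * Real.cos (ang (s, t)) = s := by
  rw [rad_eq_norm_s8, ang, ← planePoint, Complex.norm_mul_cos_arg]
  simp [planePoint]

theorem rad_mul_sin_ang_s8 (s t : ℝ) : rad (s, t) * Real.sin (ang (s, t)) = t := by
  rw [rad_eq_norm_s8, ang, ← planePoint, Complex.norm_mul_sin_arg]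
  simp [planePoint]

theorem rad_rpow_eq {s t : ℝ} (h : planePoint s t ∈ Complex.slitPlane) (α : ℝ) :
    rad (s, t) ^ α = rad (s, t) * rad (s, t) ^ (α - 1) := by
  have hpos : 0 < rad (s, t) := by
    rw [rad_eq_norm_s8]
    exact norm_pos_iff.mpr (Complex.slitPlane_ne_zero h)
  rw [Real.rpow_sub_one hpos.ne']
  field_simp

theorem press_eq_imPow (α ω : ℝ) {s t : ℝ} (h : planePoint s t ∈ Complex.slitPlane) :
    press α ω (s, t) = imPow (α - 1)
      (2 * (α * (⟨Real.cos ω + Real.cos (α * ω), Real.sin ω - Real.sin (α * ω)⟩ : ℂ))) s t := by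
  rw [imPow_eq_rad_ang _ _ h, press, Phip, Real.sin_add, Real.sin_sub]
  simp only [Complex.mul_re, Complex.mul_im, Complex.ofReal_re, Complex.ofReal_im,
    Complex.re_ofNat, Complex.im_ofNat]
  ring

theorem vel_fst_eq_almansi (α ω : ℝ) {s t : ℝ} (h : planePoint s t ∈ Complex.slitPlane) :
    (vel α ω (s, t)).1 = almansi α (α - 1)
      ⟨-Real.cos ω - Real.cos (α * ω), Real.sin (α * ω)⟩
      (α * ⟨0, Real.sin ω⟩)
      (α * ⟨-Real.sin (α * ω), -Real.cos (α * ω) - Real.cos ω⟩) s t := by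
  rw [almansi, imPow_eq_rad_ang _ _ h, imPow_eq_rad_ang _ _ h, imPow_eq_rad_ang _ _ h]
  simp only [vel, Phi1]
  have hs := rad_mul_cos_ang_s8 s t
  have ht := rad_mul_sin_ang_s8 s t
  have hr := rad_rpow_eq h α
  set r := rad (s, t)
  set θ := ang (s, t)
  rw [show α * (ω - θ) + θ = α * ω - (α - 1) * θ by ring,
    show α * θ - θ = (α - 1) * θ by ring, mul_sub α ω θ,
    Real.cos_sub, Real.sin_sub ω, Real.sin_sub (α * ω)]
  simp only [Complex.re_ofReal_mul, Complex.im_ofReal_mul]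
  rw [hr, ← hs, ← ht]
  ring

theorem vel_snd_eq_almansi (α ω : ℝ) {s t : ℝ} (h : planePoint s t ∈ Complex.slitPlane) :
    (vel α ω (s, t)).2 = almansi α (α - 1)
      ⟨-Real.sin ω, 0⟩
      (α * ⟨-Real.sin ω, 0⟩)
      (α * ⟨Real.cos (α * ω) + Real.cos ω, -Real.sin (α * ω)⟩) s t := by
  rw [almansi, imPow_eq_rad_ang _ _ h, imPow_eq_rad_ang _ _ h, imPow_eq_rad_ang _ _ h]
  simp only [vel, Phi2]
  have hs := rad_mul_cos_ang_s8 s t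
  have ht := rad_mul_sin_ang_s8 s t
  have hr := rad_rpow_eq h α
  set r := rad (s, t)
  set θ := ang (s, t)
  rw [show α * (ω - θ) + θ = α * ω - (α - 1) * θ by ring,
    show α * θ - θ = (α - 1) * θ by ring, Real.sin_sub (α * ω), Real.sin_sub ω]
  simp only [Complex.re_ofReal_mul, Complex.im_ofReal_mul]
  rw [hr, ← hs, ← ht]
  ring

/-- Momentum part of the paper's claim: the manufactured corner-singularity pair
`(y, p)` satisfies the homogeneous Stokes momentum equation
`∂₁₁yᵢ + ∂₂₂yᵢ = ∂ᵢp`, i.e. `−Δy + ∇p = 0`, classically at every point of the slit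
plane `Ω₀ = ℝ² ∖ {(x₁,0) : x₁ ≤ 0}`, for any `α, ω ∈ ℝ`. The pure second partial
derivatives `∂ⱼⱼ` are the second derivatives along the axis-parallel lines. -/
theorem manufactured_solution_momentum_equation (α ω : ℝ) (x : ℝ × ℝ)
    (hx : ¬(x.2 = 0 ∧ x.1 ≤ 0)) :
    (∃ d₁ d₂ dp : ℝ,
      HasDerivAt (deriv (fun s => (vel α ω (s, x.2)).1)) d₁ x.1 ∧
      HasDerivAt (deriv (fun s => (vel α ω (x.1, s)).1)) d₂ x.2 ∧
      HasDerivAt (fun s => press α ω (s, x.2)) dp x.1 ∧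
      d₁ + d₂ = dp) ∧
    (∃ d₁ d₂ dp : ℝ,
      HasDerivAt (deriv (fun s => (vel α ω (s, x.2)).2)) d₁ x.1 ∧
      HasDerivAt (deriv (fun s => (vel α ω (x.1, s)).2)) d₂ x.2 ∧
      HasDerivAt (fun s => press α ω (x.1, s)) dp x.2 ∧
      d₁ + d₂ = dp) := by
  obtain ⟨s, t⟩ := x
  have h : planePoint s t ∈ Complex.slitPlane := planePoint_mem_slitPlane.mpr hx
  have hs := eventually_planePoint_fst h
  have ht := eventually_planePoint_snd h
  constructor
  · obtain ⟨d₁, d₂, h₁, h₂, hd⟩ := laplacian_almansi α (α - 1)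
      ⟨-Real.cos ω - Real.cos (α * ω), Real.sin (α * ω)⟩
      (α * ⟨0, Real.sin ω⟩)
      (α * ⟨-Real.sin (α * ω), -Real.cos (α * ω) - Real.cos ω⟩) h
    refine ⟨d₁, d₂, _,
      h₁.congr_of_eventuallyEq
        (Filter.EventuallyEq.deriv (hs.mono fun _ h' => vel_fst_eq_almansi α ω h')),
      h₂.congr_of_eventuallyEq
        (Filter.EventuallyEq.deriv (ht.mono fun _ h' => vel_fst_eq_almansi α ω h')),
      (hasDerivAt_imPow_fst _ _ h).congr_of_eventuallyEq
        (hs.mono fun _ h' => press_eq_imPow α ω h'), hd.trans ?_⟩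
    congr 3
    apply Complex.ext <;> simp <;> ring
  · obtain ⟨d₁, d₂, h₁, h₂, hd⟩ := laplacian_almansi α (α - 1)
      ⟨-Real.sin ω, 0⟩
      (α * ⟨-Real.sin ω, 0⟩)
      (α * ⟨Real.cos (α * ω) + Real.cos ω, -Real.sin (α * ω)⟩) h
    refine ⟨d₁, d₂, _,
      h₁.congr_of_eventuallyEq
        (Filter.EventuallyEq.deriv (hs.mono fun _ h' => vel_snd_eq_almansi α ω h')),
      h₂.congr_of_eventuallyEq
        (Filter.EventuallyEq.deriv (ht.mono fun _ h' => vel_snd_eq_almansi α ω h')),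
      (hasDerivAt_imPow_snd _ _ h).congr_of_eventuallyEq
        (ht.mono fun _ h' => press_eq_imPow α ω h'), hd.trans ?_⟩
    congr 2
    apply Complex.ext <;> simp only [Complex.mul_re, Complex.mul_im, Complex.add_re,
      Complex.add_im, Complex.I_re, Complex.I_im, Complex.ofReal_re, Complex.ofReal_im,
      Complex.re_ofNat, Complex.im_ofNat] <;> ring
end

section
/- The corrected element satisfies n(ũ) = 0 and the error bound ‖u − ũ‖ ≤ ‖u − a‖ + (‖w‖ / |n(w)|)·|n(a − u)|; in particular ‖u − ũ‖ ≤ (1 + ‖n‖·‖w‖ / |n(w)|)·‖u − a‖, where ‖n‖ is the operator norm of the functional n. -/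
/-- Single-norm core of the paper's Lemma on error estimates for the corrected
boundary-datum approximation `π̃_h`: with `n u = 0`, `n w ≠ 0`, `λ = n a / n w` and
`ũ = a − λ w`, the corrected element satisfies `n ũ = 0`,
`‖u − ũ‖ ≤ ‖u − a‖ + (‖w‖/|n w|)|n (a − u)|`, and in particular
`‖u − ũ‖ ≤ (1 + ‖n‖‖w‖/|n w|)‖u − a‖`. -/
theorem corrected_approximation_error
    {X : Type*} [NormedAddCommGroup X] [NormedSpace ℝ X]
    (n : X →L[ℝ] ℝ) (u a w : X)
    (hu : n u = 0) (hw : n w ≠ 0) :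
    n (a - (n a / n w) • w) = 0 ∧
    ‖u - (a - (n a / n w) • w)‖ ≤ ‖u - a‖ + (‖w‖ / |n w|) * |n (a - u)| ∧
    ‖u - (a - (n a / n w) • w)‖ ≤ (1 + ‖n‖ * ‖w‖ / |n w|) * ‖u - a‖ := by
  have bound : ‖u - (a - (n a / n w) • w)‖ ≤ ‖u - a‖ + (‖w‖ / |n w|) * |n (a - u)| := by
    calc ‖u - (a - (n a / n w) • w)‖ = ‖(u - a) + (n a / n w) • w‖ := by congr 1; abel
      _ ≤ ‖u - a‖ + ‖(n a / n w) • w‖ := norm_add_le _ _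
      _ = ‖u - a‖ + (‖w‖ / |n w|) * |n (a - u)| := by
        rw [norm_smul, Real.norm_eq_abs, abs_div, map_sub, hu, sub_zero]
        ring
  refine ⟨by simp [hw], bound, bound.trans ?_⟩
  have hn : |n (a - u)| ≤ ‖n‖ * ‖u - a‖ := by
    rw [norm_sub_rev u a]
    exact n.le_opNorm (a - u)
  calc ‖u - a‖ + (‖w‖ / |n w|) * |n (a - u)|
      ≤ ‖u - a‖ + (‖w‖ / |n w|) * (‖n‖ * ‖u - a‖) := by gcongr
    _ = (1 + ‖n‖ * ‖w‖ / |n w|) * ‖u - a‖ := by ring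
end

section
/- The L²-projection of u onto the 8-dimensional space span{φ_j·e_i : j = 1,…,4, i = 1,2} (with e₁, e₂ the standard basis of ℝ²) is the function π_h u(t) = (1/32)·(φ₁(t) − 5·φ₂(t) + 19·φ₃(t) + φ₄(t))·e₁; that is, this function satisfies the orthogonality relations ∫₀⁴ (u(t) − π_h u(t))·(φ_j(t)·e_i) dt = 0 for all j ∈ {1,…,4} and i ∈ {1,2}. Moreover ∫₀⁴ π_h u(t)·N(t) dt = 3/16, which is nonzero even though ∫₀⁴ u(t)·N(t) dt = 0. (This is the paper's appendix counterexample showing that the L²(Γ)-projection does not preserve the compatibility condition ⟨u,n⟩_Γ = 0.) -/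
open intervalIntegral

/-- Hat function at the corner `a₁ = (0,0)` in the arclength parametrization of the
boundary of the unit square. -/
noncomputable def phi1 (t : ℝ) : ℝ := if t ≤ 1 then 1 - t else if t ≤ 3 then 0 else t - 3

/-- Hat function at the corner `a₂ = (1,0)`. -/
noncomputable def phi2 (t : ℝ) : ℝ := if t ≤ 1 then t else if t ≤ 2 then 2 - t else 0

/-- Hat function at the corner `a₃ = (1,1)`. -/
noncomputable def phi3 (t : ℝ) : ℝ :=
  if t ≤ 1 then 0 else if t ≤ 2 then t - 1 else if t ≤ 3 then 3 - t else 0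

/-- Hat function at the corner `a₄ = (0,1)`. -/
noncomputable def phi4 (t : ℝ) : ℝ := if t ≤ 2 then 0 else if t ≤ 3 then t - 2 else 4 - t

/-- Outward unit normal of the unit square in the arclength parametrization. -/
noncomputable def nrml (t : ℝ) : ℝ × ℝ :=
  if t ≤ 1 then (0, -1) else if t ≤ 2 then (1, 0) else if t ≤ 3 then (0, 1) else (-1, 0)

/-- The boundary datum `u`: equal to `(1,0)` on the part of the top edge with
`1/2 ≤ x₁ < 1` (i.e. `t ∈ (2, 5/2]`), and `(0,0)` elsewhere. -/
noncomputable def bdatum (t : ℝ) : ℝ × ℝ := if 2 < t ∧ t ≤ 5 / 2 then (1, 0) else (0, 0)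

/-- The claimed `L²(Γ)`-projection of `u` onto the space of continuous piecewise
linear vector fields: `π_h u = (1/32)(φ₁ − 5φ₂ + 19φ₃ + φ₄) e₁`. -/
noncomputable def projU (t : ℝ) : ℝ × ℝ :=
  ((1 / 32) * (phi1 t - 5 * phi2 t + 19 * phi3 t + phi4 t), 0)

/-- Euclidean dot product on `ℝ × ℝ`. -/
def dot (a b : ℝ × ℝ) : ℝ := a.1 * b.1 + a.2 * b.2

/-- Integral over `[0,4]` of a function given by a continuous formula on each of the intervals
cut out by the corners of the square and the jump of the boundary datum at `5/2`. -/
theorem integral_eq_sum_of_piecewise {f g₁ g₂ g₃ g₄ g₅ : ℝ → ℝ}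
    (c₁ : Continuous g₁) (c₂ : Continuous g₂) (c₃ : Continuous g₃) (c₄ : Continuous g₄)
    (c₅ : Continuous g₅)
    (h₁ : ∀ t, 0 < t → t ≤ 1 → f t = g₁ t) (h₂ : ∀ t, 1 < t → t ≤ 2 → f t = g₂ t)
    (h₃ : ∀ t, 2 < t → t ≤ 5 / 2 → f t = g₃ t) (h₄ : ∀ t, 5 / 2 < t → t ≤ 3 → f t = g₄ t)
    (h₅ : ∀ t, 3 < t → t ≤ 4 → f t = g₅ t) :
    ∫ t in (0 : ℝ)..4, f t = (∫ t in (0 : ℝ)..1, g₁ t) + (∫ t in (1 : ℝ)..2, g₂ t) +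
      (∫ t in (2 : ℝ)..5 / 2, g₃ t) + (∫ t in (5 / 2 : ℝ)..3, g₄ t) +
      ∫ t in (3 : ℝ)..4, g₅ t := by
  have key : ∀ {a b : ℝ} {g : ℝ → ℝ}, a ≤ b → Continuous g →
      (∀ t, a < t → t ≤ b → f t = g t) →
      IntervalIntegrable f MeasureTheory.volume a b ∧
        ∫ t in a..b, f t = ∫ t in a..b, g t := by
    intro a b g hab hg h
    have heq : Set.EqOn g f (Set.uIoc a b) := by
      intro t ht
      rw [Set.uIoc_of_le hab] at ht
      exact (h t ht.1 ht.2).symm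
    refine ⟨(hg.intervalIntegrable a b).congr heq, ?_⟩
    refine integral_congr_ae (Filter.Eventually.of_forall fun t ht => (heq ht).symm)
  obtain ⟨i₁, e₁⟩ := key (by norm_num) c₁ h₁
  obtain ⟨i₂, e₂⟩ := key (by norm_num) c₂ h₂
  obtain ⟨i₃, e₃⟩ := key (by norm_num) c₃ h₃
  obtain ⟨i₄, e₄⟩ := key (by norm_num) c₄ h₄
  obtain ⟨i₅, e₅⟩ := key (by norm_num) c₅ h₅
  rw [← e₁, ← e₂, ← e₃, ← e₄, ← e₅, integral_add_adjacent_intervals i₁ i₂,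
    integral_add_adjacent_intervals (i₁.trans i₂) i₃,
    integral_add_adjacent_intervals ((i₁.trans i₂).trans i₃) i₄,
    integral_add_adjacent_intervals (((i₁.trans i₂).trans i₃).trans i₄) i₅]

theorem integral_quadratic (a b p q r : ℝ) :
    ∫ t in a..b, (p + q * t + r * t ^ 2) =
      p * (b - a) + q * ((b ^ 2 - a ^ 2) / 2) + r * ((b ^ 3 - a ^ 3) / 3) := by
  rw [integral_add (Continuous.intervalIntegrable (by fun_prop) _ _)
      (Continuous.intervalIntegrable (by fun_prop) _ _),
    integral_add (Continuous.intervalIntegrable (by fun_prop) _ _)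
      (Continuous.intervalIntegrable (by fun_prop) _ _),
    integral_const_mul q fun t => t, integral_const_mul, integral_const, integral_id,
    integral_pow, smul_eq_mul]
  norm_num
  ring

/-- Paper's appendix counterexample for the `L²(Γ)`-projection: `π_h u` as defined
above satisfies the orthogonality relations characterizing the `L²`-projection onto
`span{φ_j e_i}`, and it satisfies `∫ π_h u · n = 3/16 ≠ 0` although `∫ u · n = 0`;
hence the `L²(Γ)`-projection does not preserve the compatibility condition. -/
theorem L2_projection_violates_compatibility :
    (∀ φ ∈ ({phi1, phi2, phi3, phi4} : Set (ℝ → ℝ)),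
      ∀ e ∈ ({((1 : ℝ), (0 : ℝ)), ((0 : ℝ), (1 : ℝ))} : Set (ℝ × ℝ)),
        ∫ t in (0 : ℝ)..4, dot (bdatum t - projU t) (φ t • e) = 0) ∧
    (∫ t in (0 : ℝ)..4, dot (projU t) (nrml t)) = 3 / 16 ∧
    (3 / 16 : ℝ) ≠ 0 ∧
    (∫ t in (0 : ℝ)..4, dot (bdatum t) (nrml t)) = 0 := by
  refine ⟨?_, ?_, by norm_num, ?_⟩
  · have e₂_orthogonal : ∀ φ : ℝ → ℝ,
        ∫ t in (0 : ℝ)..4, dot (bdatum t - projU t) (φ t • ((0 : ℝ), (1 : ℝ))) = 0 := by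
      intro φ
      have h : ∀ t, dot (bdatum t - projU t) (φ t • ((0 : ℝ), (1 : ℝ))) = 0 := by
        intro t
        simp only [dot, bdatum, projU]
        split_ifs <;> simp
      simp only [h, integral_zero]
    rintro φ (rfl | rfl | rfl | rfl) e (rfl | rfl)
    · rw [integral_eq_sum_of_piecewise
        (g₁ := fun t => (-1/32) + (7/32) * t + (-3/16) * t ^ 2)
        (g₂ := fun t => 0 + 0 * t + 0 * t ^ 2)
        (g₃ := fun t => 0 + 0 * t + 0 * t ^ 2)
        (g₄ := fun t => 0 + 0 * t + 0 * t ^ 2)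
        (g₅ := fun t => (3/32) + (-1/32) * t + 0 * t ^ 2)
        (by fun_prop) (by fun_prop) (by fun_prop) (by fun_prop) (by fun_prop)]
      · simp only [integral_quadratic]
        norm_num
      all_goals
        intro t hl hr
        simp only [dot, bdatum, projU, phi1, phi2, phi3, phi4, Prod.smul_mk,
          Prod.fst_sub, Prod.snd_sub, smul_eq_mul]
        grind
    · exact e₂_orthogonal _
    · rw [integral_eq_sum_of_piecewise
        (g₁ := fun t => 0 + (-1/32) * t + (3/16) * t ^ 2)
        (g₂ := fun t => (29/16) + (-77/32) * t + (3/4) * t ^ 2)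
        (g₃ := fun t => 0 + 0 * t + 0 * t ^ 2)
        (g₄ := fun t => 0 + 0 * t + 0 * t ^ 2)
        (g₅ := fun t => 0 + 0 * t + 0 * t ^ 2)
        (by fun_prop) (by fun_prop) (by fun_prop) (by fun_prop) (by fun_prop)]
      · simp only [integral_quadratic]
        norm_num
      all_goals
        intro t hl hr
        simp only [dot, bdatum, projU, phi1, phi2, phi3, phi4, Prod.smul_mk,
          Prod.fst_sub, Prod.snd_sub, smul_eq_mul]
        grind
    · exact e₂_orthogonal _
    · rw [integral_eq_sum_of_piecewise
        (g₁ := fun t => 0 + 0 * t + 0 * t ^ 2)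
        (g₂ := fun t => (-29/32) + (53/32) * t + (-3/4) * t ^ 2)
        (g₃ := fun t => (-69/32) + (77/32) * t + (-9/16) * t ^ 2)
        (g₄ := fun t => (-165/32) + (109/32) * t + (-9/16) * t ^ 2)
        (g₅ := fun t => 0 + 0 * t + 0 * t ^ 2)
        (by fun_prop) (by fun_prop) (by fun_prop) (by fun_prop) (by fun_prop)]
      · simp only [integral_quadratic]
        norm_num
      all_goals
        intro t hl hr
        simp only [dot, bdatum, projU, phi1, phi2, phi3, phi4, Prod.smul_mk,
          Prod.fst_sub, Prod.snd_sub, smul_eq_mul]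
        grind
    · exact e₂_orthogonal _
    · rw [integral_eq_sum_of_piecewise
        (g₁ := fun t => 0 + 0 * t + 0 * t ^ 2)
        (g₂ := fun t => 0 + 0 * t + 0 * t ^ 2)
        (g₃ := fun t => (23/16) + (-59/32) * t + (9/16) * t ^ 2)
        (g₄ := fun t => (55/16) + (-91/32) * t + (9/16) * t ^ 2)
        (g₅ := fun t => (-1/8) + (1/32) * t + 0 * t ^ 2)
        (by fun_prop) (by fun_prop) (by fun_prop) (by fun_prop) (by fun_prop)]
      · simp only [integral_quadratic]
        norm_num
      all_goals
        intro t hl hr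
        simp only [dot, bdatum, projU, phi1, phi2, phi3, phi4, Prod.smul_mk,
          Prod.fst_sub, Prod.snd_sub, smul_eq_mul]
        grind
    · exact e₂_orthogonal _
  · rw [integral_eq_sum_of_piecewise
      (g₁ := fun t => 0 + 0 * t + 0 * t ^ 2)
      (g₂ := fun t => (-29/32) + (3/4) * t + 0 * t ^ 2)
      (g₃ := fun t => 0 + 0 * t + 0 * t ^ 2)
      (g₄ := fun t => 0 + 0 * t + 0 * t ^ 2)
      (g₅ := fun t => (-1/32) + 0 * t + 0 * t ^ 2)
      (by fun_prop) (by fun_prop) (by fun_prop) (by fun_prop) (by fun_prop)]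
    · simp only [integral_quadratic]
      norm_num
    all_goals
      intro t hl hr
      simp only [dot, projU, nrml, phi1, phi2, phi3, phi4]
      grind
  · rw [integral_eq_sum_of_piecewise
      (g₁ := fun t => 0 + 0 * t + 0 * t ^ 2)
      (g₂ := fun t => 0 + 0 * t + 0 * t ^ 2)
      (g₃ := fun t => 0 + 0 * t + 0 * t ^ 2)
      (g₄ := fun t => 0 + 0 * t + 0 * t ^ 2)
      (g₅ := fun t => 0 + 0 * t + 0 * t ^ 2)
      (by fun_prop) (by fun_prop) (by fun_prop) (by fun_prop) (by fun_prop)]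
    · simp only [integral_quadratic]
      norm_num
    all_goals
      intro t hl hr
      simp only [dot, bdatum, nrml]
      grind
end

section
/- The Carstensen interpolant of u, defined componentwise by P_h u := Σ_{j=1}^{4} ((∫₀⁴ u(t)·φ_j(t) dt)/(∫₀⁴ φ_j(t) dt))·φ_j, equals P_h u(t) = (1/8)·(3·φ₃(t) + φ₄(t))·e₁, and it satisfies ∫₀⁴ P_h u(t)·N(t) dt = 1/8, which is nonzero even though ∫₀⁴ u(t)·N(t) dt = 0. (This is the paper's appendix counterexample showing that the Carstensen interpolant does not preserve the compatibility condition ⟨u,n⟩_Γ = 0.) -/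
open intervalIntegral

/-- The componentwise Carstensen coefficient vector
`(∫ u φ dt) / (∫ φ dt)` associated with a hat function `φ`. -/
noncomputable def carstensenCoeff (φ : ℝ → ℝ) : ℝ × ℝ :=
  ((∫ s in (0 : ℝ)..4, (bdatum s).1 * φ s) / (∫ s in (0 : ℝ)..4, φ s),
   (∫ s in (0 : ℝ)..4, (bdatum s).2 * φ s) / (∫ s in (0 : ℝ)..4, φ s))

/-- The Carstensen interpolant `P_h u = Σ_j ((∫ u φ_j)/(∫ φ_j)) φ_j`. -/
noncomputable def carstensenInterp (t : ℝ) : ℝ × ℝ :=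
  phi1 t • carstensenCoeff phi1 + phi2 t • carstensenCoeff phi2 +
    phi3 t • carstensenCoeff phi3 + phi4 t • carstensenCoeff phi4

/-- A function agreeing with an affine one on `(x, y]` is integrable there, with the expected
integral. -/
theorem intervalIntegrable_and_integral_eq_of_affine {f : ℝ → ℝ} {x y a b : ℝ} (hxy : x ≤ y)
    (h : ∀ t, x < t → t ≤ y → f t = a * t + b) :
    IntervalIntegrable f MeasureTheory.volume x y ∧
      ∫ t in x..y, f t = a * ((y ^ 2 - x ^ 2) / 2) + b * (y - x) := by
  have hc : Continuous fun t : ℝ => a * t + b := by fun_prop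
  have heq : Set.EqOn f (fun t => a * t + b) (Set.uIoc x y) := by
    intro t ht
    rw [Set.uIoc_of_le hxy] at ht
    exact h t ht.1 ht.2
  refine ⟨(hc.intervalIntegrable x y).congr heq.symm, ?_⟩
  rw [integral_congr_ae (Filter.Eventually.of_forall fun t ht => heq ht),
    integral_add (Continuous.intervalIntegrable (by fun_prop) _ _)
      (Continuous.intervalIntegrable (by fun_prop) _ _)]
  rw [intervalIntegral.integral_const_mul a (fun t => t), integral_id, integral_const, smul_eq_mul]
  ring

/-- Integral over `[0, 4]` of a function that is affine on each edge of the square, where the top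
edge is split at its midpoint. -/
theorem integral_eq_of_piecewise_affine {f : ℝ → ℝ} (a₁ b₁ a₂ b₂ a₃ b₃ a₄ b₄ a₅ b₅ : ℝ)
    (h₁ : ∀ t, 0 < t → t ≤ 1 → f t = a₁ * t + b₁)
    (h₂ : ∀ t, 1 < t → t ≤ 2 → f t = a₂ * t + b₂)
    (h₃ : ∀ t, 2 < t → t ≤ 5 / 2 → f t = a₃ * t + b₃)
    (h₄ : ∀ t, 5 / 2 < t → t ≤ 3 → f t = a₄ * t + b₄)
    (h₅ : ∀ t, 3 < t → t ≤ 4 → f t = a₅ * t + b₅) :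
    ∫ t in (0 : ℝ)..4, f t =
      (a₁ / 2 + b₁) + (a₂ * 3 / 2 + b₂) + (a₃ * 9 / 8 + b₃ / 2) + (a₄ * 11 / 8 + b₄ / 2) +
        (a₅ * 7 / 2 + b₅) := by
  obtain ⟨i₁, e₁⟩ := intervalIntegrable_and_integral_eq_of_affine (by norm_num) h₁
  obtain ⟨i₂, e₂⟩ := intervalIntegrable_and_integral_eq_of_affine (by norm_num) h₂
  obtain ⟨i₃, e₃⟩ := intervalIntegrable_and_integral_eq_of_affine (by norm_num) h₃
  obtain ⟨i₄, e₄⟩ := intervalIntegrable_and_integral_eq_of_affine (by norm_num) h₄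
  obtain ⟨i₅, e₅⟩ := intervalIntegrable_and_integral_eq_of_affine (by norm_num) h₅
  rw [← integral_add_adjacent_intervals (((i₁.trans i₂).trans i₃).trans i₄) i₅,
    ← integral_add_adjacent_intervals ((i₁.trans i₂).trans i₃) i₄,
    ← integral_add_adjacent_intervals (i₁.trans i₂) i₃,
    ← integral_add_adjacent_intervals i₁ i₂, e₁, e₂, e₃, e₄, e₅]
  ring

/-- A weighted integral against the datum only sees the half edge `(2, 5/2]`. -/
theorem integral_bdatum_fst_mul {φ : ℝ → ℝ} {a b : ℝ}
    (h : ∀ t, 2 < t → t ≤ 5 / 2 → φ t = a * t + b) :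
    ∫ s in (0 : ℝ)..4, (bdatum s).1 * φ s = a * 9 / 8 + b / 2 := by
  rw [integral_eq_of_piecewise_affine 0 0 0 0 a b 0 0 0 0]
  · ring
  all_goals
    intro t ht ht'
    grind [bdatum]

theorem bdatum_snd (t : ℝ) : (bdatum t).2 = 0 := by
  unfold bdatum
  split_ifs <;> rfl

theorem carstensenCoeff_phi1 : carstensenCoeff phi1 = (0, 0) := by
  have h : ∫ s in (0 : ℝ)..4, (bdatum s).1 * phi1 s = 0 := by
    rw [integral_bdatum_fst_mul (a := 0) (b := 0) (by grind [phi1])]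
    norm_num
  simp [carstensenCoeff, bdatum_snd, h]

theorem carstensenCoeff_phi2 : carstensenCoeff phi2 = (0, 0) := by
  have h : ∫ s in (0 : ℝ)..4, (bdatum s).1 * phi2 s = 0 := by
    rw [integral_bdatum_fst_mul (a := 0) (b := 0) (by grind [phi2])]
    norm_num
  simp [carstensenCoeff, bdatum_snd, h]

theorem carstensenCoeff_phi3 : carstensenCoeff phi3 = (3 / 8, 0) := by
  have h : ∫ s in (0 : ℝ)..4, (bdatum s).1 * phi3 s = 3 / 8 := by
    rw [integral_bdatum_fst_mul (a := -1) (b := 3) (by grind [phi3])]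
    norm_num
  have h' : ∫ s in (0 : ℝ)..4, phi3 s = 1 := by
    rw [integral_eq_of_piecewise_affine 0 0 1 (-1) (-1) 3 (-1) 3 0 0]
    · norm_num
    all_goals grind [phi3]
  simp [carstensenCoeff, bdatum_snd, h, h']

theorem carstensenCoeff_phi4 : carstensenCoeff phi4 = (1 / 8, 0) := by
  have h : ∫ s in (0 : ℝ)..4, (bdatum s).1 * phi4 s = 1 / 8 := by
    rw [integral_bdatum_fst_mul (a := 1) (b := -2) (by grind [phi4])]
    norm_num
  have h' : ∫ s in (0 : ℝ)..4, phi4 s = 1 := by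
    rw [integral_eq_of_piecewise_affine 0 0 0 0 1 (-2) 1 (-2) (-1) 4]
    · norm_num
    all_goals grind [phi4]
  simp [carstensenCoeff, bdatum_snd, h, h']

theorem carstensenInterp_eq (t : ℝ) :
    carstensenInterp t = ((1 / 8) * (3 * phi3 t + phi4 t), 0) := by
  simp only [carstensenInterp, carstensenCoeff_phi1, carstensenCoeff_phi2, carstensenCoeff_phi3,
    carstensenCoeff_phi4, Prod.smul_mk, Prod.mk_add_mk, smul_eq_mul, Prod.mk.injEq]
  constructor <;> ring

/-- Paper's appendix counterexample for the Carstensen interpolant: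
`P_h u = (1/8)(3φ₃ + φ₄) e₁` on `[0,4)`, and `∫ P_h u · n = 1/8 ≠ 0` although
`∫ u · n = 0`; hence the Carstensen interpolant does not preserve the compatibility
condition. -/
theorem carstensen_interpolant_violates_compatibility :
    (∀ t ∈ Set.Ico (0 : ℝ) 4,
      carstensenInterp t = ((1 / 8) * (3 * phi3 t + phi4 t), 0)) ∧
    (∫ t in (0 : ℝ)..4, dot (carstensenInterp t) (nrml t)) = 1 / 8 ∧
    (1 / 8 : ℝ) ≠ 0 ∧
    (∫ t in (0 : ℝ)..4, dot (bdatum t) (nrml t)) = 0 := by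
  refine ⟨fun t _ => carstensenInterp_eq t, ?_, by norm_num, ?_⟩
  · simp only [carstensenInterp_eq]
    rw [integral_eq_of_piecewise_affine 0 0 (3 / 8) (-3 / 8) 0 0 0 0 (1 / 8) (-1 / 2)]
    · norm_num
    all_goals
      intro t ht ht'
      grind [dot, nrml, phi3, phi4]
  · rw [integral_eq_of_piecewise_affine 0 0 0 0 0 0 0 0 0 0]
    · norm_num
    all_goals
      intro t ht ht'
      grind [dot, nrml, bdatum]
end

section
/- Let y ∈ X with trace u := γ(y), let u_h ∈ T_h, and let v ∈ X be such that u_h − γ(v) ∈ T_h. Then the element w := v + S(u_h − γ(v)) satisfies γ(w) = u_h and the error bound ρ(y − w) ≤ (1 + c₁·c₂)·‖y − v‖_X + c₁·‖u − u_h‖_T. (This is the paper's Lemma 'from Y_{*h} to Y_h': for each discrete function v there is a discrete function w attaining the approximate boundary values u_h whose error in the gradient seminorm is controlled by the full-norm error of v and the boundary approximation error.) -/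
/-- Paper's Lemma "from `Y_{*h}` to `Y_h`": abstract version with `X = H¹(Ω)^d`,
gradient seminorm `ρ`, trace map `γ`, discrete trace space `T_h` and discrete
harmonic extension `S`. Given a discrete boundary datum `u_h ∈ T_h` and any `v` with
`u_h − γ v ∈ T_h`, the element `w = v + S(u_h − γ v)` attains the boundary values
`u_h` and satisfies `ρ(y − w) ≤ (1 + c₁ c₂)‖y − v‖ + c₁‖γ y − u_h‖`. -/
theorem discrete_extension_error_bound
    {X T : Type*} [NormedAddCommGroup X] [NormedSpace ℝ X]
    [NormedAddCommGroup T] [NormedSpace ℝ T]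
    (ρ : Seminorm ℝ X) (hρ : ∀ x : X, ρ x ≤ ‖x‖)
    (γ : X →ₗ[ℝ] T) (c₂ : ℝ) (hc₂ : 0 < c₂) (hγ : ∀ x : X, ‖γ x‖ ≤ c₂ * ‖x‖)
    (Th : Submodule ℝ T) (S : Th →ₗ[ℝ] X)
    (c₁ : ℝ) (hc₁ : 0 < c₁)
    (hS : ∀ t : Th, γ (S t) = (t : T)) (hSstab : ∀ t : Th, ρ (S t) ≤ c₁ * ‖t‖)
    (y : X) (uh : T) (huh : uh ∈ Th) (v : X) (hmem : uh - γ v ∈ Th) :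
    γ (v + S ⟨uh - γ v, hmem⟩) = uh ∧
    ρ (y - (v + S ⟨uh - γ v, hmem⟩)) ≤
      (1 + c₁ * c₂) * ‖y - v‖ + c₁ * ‖γ y - uh‖ := by
  refine ⟨by rw [map_add, hS, add_sub_cancel], ?_⟩
  have h_trace : ‖uh - γ v‖ ≤ c₂ * ‖y - v‖ + ‖γ y - uh‖ := calc
    ‖uh - γ v‖ = ‖γ (y - v) - (γ y - uh)‖ := by rw [map_sub]; congr 1; abel
    _ ≤ ‖γ (y - v)‖ + ‖γ y - uh‖ := norm_sub_le _ _
    _ ≤ c₂ * ‖y - v‖ + ‖γ y - uh‖ := by gcongr; exact hγ _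
  calc ρ (y - (v + S ⟨uh - γ v, hmem⟩))
      = ρ ((y - v) - S ⟨uh - γ v, hmem⟩) := by rw [sub_sub]
    _ ≤ ρ (y - v) + ρ (S ⟨uh - γ v, hmem⟩) := map_sub_le_add ρ _ _
    _ ≤ ‖y - v‖ + c₁ * ‖uh - γ v‖ := add_le_add (hρ _) (hSstab _)
    _ ≤ ‖y - v‖ + c₁ * (c₂ * ‖y - v‖ + ‖γ y - uh‖) := by gcongr
    _ = (1 + c₁ * c₂) * ‖y - v‖ + c₁ * ‖γ y - uh‖ := by ring
end

section
/- Let Y_h ⊆ X be a subspace with γ(Y_h) ⊆ T_h and S(T_h) ⊆ Y_h, and set Y₀h := {z ∈ Y_h : γ(z) = 0}. Then for every v ∈ X with γ(v) = 0 and every v_h ∈ Y_h, the element v_h − S(γ(v_h)) belongs to Y₀h and satisfies ρ(v − (v_h − S(γ(v_h)))) ≤ (1 + c₁·c₂)·‖v − v_h‖_X; consequently inf over z ∈ Y₀h of ρ(v − z) is at most (1 + c₁·c₂) times inf over v_h ∈ Y_h of ‖v − v_h‖_X. (This is the paper's Corollary on best approximation in Y₀h: the best approximation from the zero-trace discrete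 space in the gradient seminorm is controlled by the best approximation from the full discrete space in the full norm.) -/
/-- Paper's Corollary on best approximation in `Y₀h`: abstract version with
`X = H¹(Ω)^d`, gradient seminorm `ρ`, trace map `γ`, discrete trace space `T_h`,
discrete harmonic extension `S` and discrete space `Y_h` with `γ(Y_h) ⊆ T_h`,
`S(T_h) ⊆ Y_h`. For `v` with zero trace and any `v_h ∈ Y_h`, the corrected element
`v_h − S(γ v_h)` lies in `Y₀h = {z ∈ Y_h : γ z = 0}` and satisfies
`ρ(v − (v_h − S(γ v_h))) ≤ (1 + c₁ c₂)‖v − v_h‖`; consequently the best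
approximation from `Y₀h` in the seminorm `ρ` is controlled by the best approximation
from `Y_h` in the full norm. -/
theorem best_approx_zero_trace_space
    {X T : Type*} [NormedAddCommGroup X] [NormedSpace ℝ X]
    [NormedAddCommGroup T] [NormedSpace ℝ T]
    (ρ : Seminorm ℝ X) (hρ : ∀ x : X, ρ x ≤ ‖x‖)
    (γ : X →ₗ[ℝ] T) (c₂ : ℝ) (hc₂ : 0 < c₂) (hγ : ∀ x : X, ‖γ x‖ ≤ c₂ * ‖x‖)
    (Th : Submodule ℝ T) (S : Th →ₗ[ℝ] X)
    (c₁ : ℝ) (hc₁ : 0 < c₁)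
    (hS : ∀ t : Th, γ (S t) = (t : T)) (hSstab : ∀ t : Th, ρ (S t) ≤ c₁ * ‖t‖)
    (Yh : Submodule ℝ X) (hγYh : ∀ z ∈ Yh, γ z ∈ Th)
    (hSYh : ∀ t : Th, S t ∈ Yh)
    (v : X) (hv : γ v = 0) :
    (∀ vh, ∀ hvh : vh ∈ Yh,
      (vh - S ⟨γ vh, hγYh vh hvh⟩ ∈ Yh ∧ γ (vh - S ⟨γ vh, hγYh vh hvh⟩) = 0) ∧
      ρ (v - (vh - S ⟨γ vh, hγYh vh hvh⟩)) ≤ (1 + c₁ * c₂) * ‖v - vh‖) ∧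
    sInf {r : ℝ | ∃ z ∈ Yh, γ z = 0 ∧ r = ρ (v - z)} ≤
      (1 + c₁ * c₂) * sInf {r : ℝ | ∃ vh ∈ Yh, r = ‖v - vh‖} := by
  have key : ∀ vh, ∀ hvh : vh ∈ Yh,
      (vh - S ⟨γ vh, hγYh vh hvh⟩ ∈ Yh ∧ γ (vh - S ⟨γ vh, hγYh vh hvh⟩) = 0) ∧
      ρ (v - (vh - S ⟨γ vh, hγYh vh hvh⟩)) ≤ (1 + c₁ * c₂) * ‖v - vh‖ := by
    intro vh hvh
    refine ⟨⟨Yh.sub_mem hvh (hSYh _), by rw [map_sub, hS, sub_self]⟩, ?_⟩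
    have htrace : ‖γ vh‖ ≤ c₂ * ‖v - vh‖ := by
      simpa [hv] using hγ (v - vh)
    calc ρ (v - (vh - S ⟨γ vh, hγYh vh hvh⟩))
        = ρ ((v - vh) + S ⟨γ vh, hγYh vh hvh⟩) := by rw [sub_sub_eq_add_sub, add_sub_right_comm]
      _ ≤ ρ (v - vh) + ρ (S ⟨γ vh, hγYh vh hvh⟩) := map_add_le_add ρ _ _
      _ ≤ ‖v - vh‖ + c₁ * ‖γ vh‖ := add_le_add (hρ _) (hSstab _)
      _ ≤ ‖v - vh‖ + c₁ * (c₂ * ‖v - vh‖) := by gcongr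
      _ = (1 + c₁ * c₂) * ‖v - vh‖ := by ring
  refine ⟨key, ?_⟩
  have hpos : 0 < 1 + c₁ * c₂ := by positivity
  rw [← div_le_iff₀' hpos]
  refine le_csInf ⟨_, 0, Yh.zero_mem, rfl⟩ ?_
  rintro _ ⟨vh, hvh, rfl⟩
  rw [div_le_iff₀' hpos]
  obtain ⟨⟨hmem, hzero⟩, hle⟩ := key vh hvh
  refine le_trans (csInf_le ⟨0, ?_⟩ ⟨_, hmem, hzero, rfl⟩) hle
  rintro _ ⟨z, -, -, rfl⟩
  exact apply_nonneg ρ _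
end
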